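/- For every dimension d ≥ 1, every p ∈ [0,1], and every even integer t ≥ 2 with χ_t > 0, one has χ_t ≤ (4/3)·(4ξ_t + 1)^d · (θ_{t/2})². -/

import Mathlib

/-!
Common set-up: nearest-neighbour oriented bond percolation on the space-time
lattice `ℤ^d × ℕ`.  A (potential) bond is a pair `((x, s), y)`, representing
the oriented bond from `(x, s)` to `(y, s + 1)` (it is a genuine bond when
`‖x - y‖₁ = 1`).  Each bond is occupied (`true`) with probability `p`,
independently of all other bonds.  The product Bernoulli(`p`) measure on
configurations is constructed explicitly as the pushforward of the uniform
measure on `[0,1)`: the binary digits of a uniform sample are i.i.d. fair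
coin flips, which are re-packed (via the pairing function) into an i.i.d.
sequence of uniform random variables `unif i`, one for each bond, and the
bond indexed by `i` is occupied exactly when `unif i < p`.
-/

open MeasureTheory Filter Set
open scoped Classical ENNReal Topology

namespace OrientedPercolation

/-- A potential bond of the `d`-dimensional space-time lattice: `((x, s), y)`
represents the oriented pair from `(x, s)` to `(y, s + 1)`. -/
abbrev Bond (d : ℕ) := ((Fin d → ℤ) × ℕ) × (Fin d → ℤ)

/-- A bond configuration: each potential bond is occupied (`true`) or vacant (`false`). -/
abbrev Config (d : ℕ) := Bond d → Bool

/-- The ℓ¹-norm of a point of `ℤ^d`. -/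
def norm1 {d : ℕ} (x : Fin d → ℤ) : ℤ := ∑ i, |x i|

/-- The squared Euclidean norm of a point of `ℤ^d`. -/
def normSq {d : ℕ} (x : Fin d → ℤ) : ℤ := ∑ i, (x i) ^ 2

/-- The `n`-th binary digit of `x ∈ [0,1)`. -/
noncomputable def digit (n : ℕ) (x : ℝ) : ℕ := ⌊x * 2 ^ (n + 1)⌋.toNat % 2

/-- From a single uniform sample on `[0,1)`, an i.i.d. sequence of uniform
samples on `[0,1]`, obtained by splitting the binary digits via the pairing
function. -/
noncomputable def unif (i : ℕ) (x : ℝ) : ℝ :=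
  ∑' k : ℕ, (digit (Nat.pair i k) x : ℝ) / 2 ^ (k + 1)

/-- An injective encoding of the bonds by natural numbers. -/
noncomputable def enc (d : ℕ) : Bond d → ℕ := (exists_injective_nat (Bond d)).choose

/-- The i.i.d. Bernoulli(`p`) bond configuration built from a uniform sample `x`. -/
noncomputable def config (d : ℕ) (p : ℝ) (x : ℝ) : Config d :=
  fun b => if unif (enc d b) x < p then true else false

/-- The product Bernoulli(`p`) measure `ℙ_p` on bond configurations. -/
noncomputable def P (d : ℕ) (p : ℝ) : Measure (Config d) :=
  Measure.map (config d p) ((volume : Measure ℝ).restrict (Set.Ico 0 1))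

/-- `ConnectedIn ω R x s y t` : either `(x,s) = (y,t) ∈ R`, or there is a path of
occupied bonds from `(x, s)` to `(y, t)`, all of whose vertices lie in `R`. -/
def ConnectedIn {d : ℕ} (ω : Config d) (R : Set ((Fin d → ℤ) × ℕ))
    (x : Fin d → ℤ) (s : ℕ) (y : Fin d → ℤ) (t : ℕ) : Prop :=
  (x = y ∧ s = t ∧ (x, s) ∈ R) ∨
  (s < t ∧ ∃ v : ℕ → (Fin d → ℤ), v s = x ∧ v t = y ∧
    (∀ j, s ≤ j → j ≤ t → (v j, j) ∈ R) ∧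
    (∀ j, s ≤ j → j < t → norm1 (v (j + 1) - v j) = 1 ∧ ω ((v j, j), v (j + 1)) = true))

/-- `(x, s) → (y, t)` : `(x,s) = (y,t)` or there is a path of occupied bonds from
`(x, s)` to `(y, t)`. -/
def Connected {d : ℕ} (ω : Config d) (x : Fin d → ℤ) (s : ℕ) (y : Fin d → ℤ) (t : ℕ) : Prop :=
  ConnectedIn ω Set.univ x s y t

/-- The survival probability `θ_t = ℙ_p((o,0) → t)`. -/
noncomputable def theta (d : ℕ) (p : ℝ) (t : ℕ) : ℝ :=
  (P d p {ω | ∃ y, Connected ω 0 0 y t}).toReal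

/-- The two-point function `τ(x,t) = ℙ_p((o,0) → (x,t))`. -/
noncomputable def tau (d : ℕ) (p : ℝ) (x : Fin d → ℤ) (t : ℕ) : ℝ :=
  (P d p {ω | Connected ω 0 0 x t}).toReal

/-- The expected number of vertices at time `t` connected from the origin,
`χ_t = Σ_x τ(x,t)`. -/
noncomputable def chi (d : ℕ) (p : ℝ) (t : ℕ) : ℝ := ∑' x : Fin d → ℤ, tau d p x t

/-- The gyration radius `ξ_t = (χ_t⁻¹ Σ_x |x|² τ(x,t))^(1/2)`. -/
noncomputable def xi (d : ℕ) (p : ℝ) (t : ℕ) : ℝ :=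
  Real.sqrt ((∑' x : Fin d → ℤ, (normSq x : ℝ) * tau d p x t) / chi d p t)

/-- The critical point `p_c = inf {p ∈ [0,1] : θ_∞ > 0}` (here `θ_∞ = lim_t θ_t = inf_t θ_t`,
since `θ_t` is nonincreasing in `t` and nonnegative). -/
noncomputable def pc (d : ℕ) : ℝ :=
  sInf {p ∈ Set.Icc (0 : ℝ) 1 | 0 < ⨅ t : ℕ, theta d p t}

/-- The rectangle `[a, b] × [0, t]` (for `d = 1`). -/
def rect (a b : ℤ) (t : ℕ) : Set ((Fin 1 → ℤ) × ℕ) :=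
  {v | a ≤ v.1 0 ∧ v.1 0 ≤ b ∧ v.2 ≤ t}

/-- The rectangle `[a, b] × [0, t]` is crossed vertically: there is a path of occupied
bonds inside the rectangle from some vertex `(x, 0)` to some vertex `(y, t)`. -/
def CrossedVert (ω : Config 1) (a b : ℤ) (t : ℕ) : Prop :=
  ∃ x y : Fin 1 → ℤ, ConnectedIn ω (rect a b t) x 0 y t

/-- The rectangle `[a, b] × [0, t]` is crossed from left to right: there is a path of
occupied bonds inside the rectangle containing a vertex with first coordinate `a` and
a vertex with first coordinate `b`. -/
def CrossedHoriz (ω : Config 1) (a b : ℤ) (t : ℕ) : Prop :=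
  ∃ (x y : Fin 1 → ℤ) (s u : ℕ), x 0 = a ∧ y 0 = b ∧
    (ConnectedIn ω (rect a b t) x s y u ∨ ConnectedIn ω (rect a b t) y u x s)

/-- `V_p(w, t) = ℙ_p([0,w] × [0,t] is crossed vertically)`. -/
noncomputable def V (p : ℝ) (w : ℕ) (t : ℕ) : ℝ :=
  (P 1 p {ω | CrossedVert ω 0 w t}).toReal

/-- `H_p(w, t) = ℙ_p([0,w] × [0,t] is crossed from left to right)`. -/
noncomputable def H (p : ℝ) (w : ℕ) (t : ℕ) : ℝ :=
  (P 1 p {ω | CrossedHoriz ω 0 w t}).toReal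

/-- The event that `(o, 0)` is connected, inside the box `B_o = [-w,w] × [0,t]`, to the
boundary `∂B_o = {(x,s) ∈ B_o : s = t or |x| = w}`. -/
def ToBoundary (ω : Config 1) (w : ℕ) (t : ℕ) : Prop :=
  ∃ (y : Fin 1 → ℤ) (s : ℕ), (s = t ∨ |y 0| = w) ∧
    ConnectedIn ω (rect (-(w : ℤ)) w t) 0 0 y s

/-- The fair coin on `{0, 1} ⊆ ℕ`. -/
noncomputable def coin : Measure ℕ :=
  (2⁻¹ : ℝ≥0∞) • Measure.dirac 0 + (2⁻¹ : ℝ≥0∞) • Measure.dirac 1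

instance : IsProbabilityMeasure coin := ⟨by simp [coin, ENNReal.inv_two_add_inv_two]⟩

lemma measurable_digit (n : ℕ) : Measurable (digit n) := by
  unfold digit
  have h1 : Measurable (fun x : ℝ => ⌊x * 2 ^ (n + 1)⌋) :=
    Int.measurable_floor.comp (measurable_id.mul_const _)
  have h2 : Measurable (fun z : ℤ => z.toNat % 2) := measurable_of_countable _
  exact h2.comp h1

lemma digit_succ (n : ℕ) (x : ℝ) : digit (n + 1) x = digit n (2 * x) := by
  unfold digit
  rw [show x * 2 ^ (n + 1 + 1) = 2 * x * 2 ^ (n + 1) by ring]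

lemma digit_add_one (n : ℕ) (x : ℝ) (hx : 0 ≤ x) : digit n (x + 1) = digit n x := by
  unfold digit
  have h : (x + 1) * 2 ^ (n + 1) = x * 2 ^ (n + 1) + ((2 ^ (n + 1) : ℤ) : ℝ) := by
    push_cast; ring
  rw [h, Int.floor_add_intCast]
  have h0 : 0 ≤ ⌊x * 2 ^ (n + 1)⌋ := Int.floor_nonneg.2 (by positivity)
  have h1 : (2 ^ (n + 1) : ℤ) = 2 * 2 ^ n := by ring
  have h2 : (0 : ℤ) ≤ 2 ^ n := by positivity
  rw [h1]
  omega

lemma digit_zero_low (x : ℝ) (h0 : 0 ≤ x) (h1 : x < 1 / 2) : digit 0 x = 0 := by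
  unfold digit
  have : ⌊x * 2 ^ (0 + 1)⌋ = 0 := by
    rw [Int.floor_eq_iff]; constructor <;> norm_num <;> linarith
  rw [this]; rfl

lemma digit_zero_high (x : ℝ) (h0 : 1 / 2 ≤ x) (h1 : x < 1) : digit 0 x = 1 := by
  unfold digit
  have : ⌊x * 2 ^ (0 + 1)⌋ = 1 := by
    rw [Int.floor_eq_iff]; constructor <;> norm_num <;> linarith
  rw [this]; rfl

lemma coin_apply (s : Set ℕ) :
    coin s = 2⁻¹ * s.indicator 1 0 + 2⁻¹ * s.indicator 1 1 := by
  simp [coin]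

lemma vol_half (A : Set ℝ) (c : ℝ) :
    volume ((fun x => 2 * x + c) ⁻¹' A) = 2⁻¹ * volume A := by
  have : (fun x : ℝ => 2 * x + c) ⁻¹' A = (fun x => 2 * x) ⁻¹' ((fun x => x + c) ⁻¹' A) := rfl
  rw [this, Real.volume_preimage_mul_left (by norm_num), measure_preimage_add_right]
  congr 1
  rw [abs_of_pos (by norm_num), ENNReal.ofReal_inv_of_pos (by norm_num)]
  simp

lemma digit_prob (n : ℕ) : ∀ u : ℕ → Set ℕ,
    volume {x : ℝ | x ∈ Ico (0 : ℝ) 1 ∧ ∀ k < n, digit k x ∈ u k} =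
      ∏ k ∈ Finset.range n, coin (u k) := by
  induction n with
  | zero => intro u; simp [Set.Ico_def]
  | succ n ih =>
    intro u
    set B : Set ℝ := {x : ℝ | x ∈ Ico (0 : ℝ) 1 ∧ ∀ k < n, digit k x ∈ u (k + 1)} with hB
    have hBv : volume B = ∏ k ∈ Finset.range n, coin (u (k + 1)) := ih (fun k => u (k + 1))
    have hsplit : {x : ℝ | x ∈ Ico (0 : ℝ) 1 ∧ ∀ k < n + 1, digit k x ∈ u k} =
        (if 0 ∈ u 0 then (fun x : ℝ => 2 * x + 0) ⁻¹' B else ∅) ∪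
        (if 1 ∈ u 0 then (fun x : ℝ => 2 * x + (-1)) ⁻¹' B else ∅) := by
      have key : ∀ (x : ℝ), (∀ k < n + 1, digit k x ∈ u k) ↔
          (digit 0 x ∈ u 0 ∧ ∀ k < n, digit k (2 * x) ∈ u (k + 1)) := by
        intro x
        constructor
        · intro h
          exact ⟨h 0 (by omega), fun k hk => by rw [← digit_succ]; exact h _ (by omega)⟩
        · rintro ⟨h0, h⟩ k hk
          rcases k with _ | k
          · exact h0
          · rw [digit_succ]; exact h k (by omega)
      ext x
      simp only [mem_ofPred_eq, key, mem_union]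
      have e1 : (x ∈ if 0 ∈ u 0 then (fun x : ℝ => 2 * x + 0) ⁻¹' B else ∅) ↔
          (0 ∈ u 0 ∧ 2 * x ∈ B) := by split_ifs with h <;> simp [h]
      have e2 : (x ∈ if 1 ∈ u 0 then (fun x : ℝ => 2 * x + (-1)) ⁻¹' B else ∅) ↔
          (1 ∈ u 0 ∧ 2 * x + (-1) ∈ B) := by split_ifs with h <;> simp [h]
      rw [e1, e2]
      have shift : 1 / 2 ≤ x → ∀ k, digit k (2 * x) = digit k (2 * x + (-1)) := by
        intro hx k
        rw [← digit_add_one k (2 * x + (-1)) (by linarith)]; congr 1; ring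
      constructor
      · rintro ⟨⟨hx0, hx1⟩, h0, h⟩
        rcases lt_or_ge x (1 / 2) with hx | hx
        · left
          rw [digit_zero_low x hx0 hx] at h0
          exact ⟨h0, ⟨by linarith, by linarith⟩, h⟩
        · right
          rw [digit_zero_high x hx hx1] at h0
          refine ⟨h0, ⟨by linarith, by linarith⟩, fun k hk => ?_⟩
          rw [← shift hx]; exact h k hk
      · rintro (⟨h0, ⟨hx0, hx1⟩, h⟩ | ⟨h0, ⟨hx0, hx1⟩, h⟩)
        · refine ⟨⟨by linarith, by linarith⟩, ?_, h⟩
          rw [digit_zero_low x (by linarith) (by linarith)]; exact h0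
        · refine ⟨⟨by linarith, by linarith⟩, ?_, fun k hk => ?_⟩
          · rw [digit_zero_high x (by linarith) (by linarith)]; exact h0
          · rw [shift (by linarith)]; exact h k hk
    have hBm : MeasurableSet B := by
      have : B = Ico (0 : ℝ) 1 ∩ ⋂ k, ⋂ (_ : k < n), digit k ⁻¹' (u (k + 1)) := by
        ext x; simp [hB]
      rw [this]
      exact measurableSet_Ico.inter (MeasurableSet.iInter fun k => MeasurableSet.iInter fun _ =>
        measurable_digit k (MeasurableSet.of_discrete))
    rw [hsplit, measure_union, Finset.prod_range_succ', coin_apply (u 0), ← hBv]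
    · have f1 : volume (if 0 ∈ u 0 then (fun x : ℝ => 2 * x + 0) ⁻¹' B else ∅) =
          2⁻¹ * (u 0).indicator 1 0 * volume B := by
        split_ifs with h
        · rw [vol_half]; simp [h]
        · simp [h]
      have f2 : volume (if 1 ∈ u 0 then (fun x : ℝ => 2 * x + (-1)) ⁻¹' B else ∅) =
          2⁻¹ * (u 0).indicator 1 1 * volume B := by
        split_ifs with h
        · rw [vol_half]; simp [h]
        · simp [h]
      rw [f1, f2, ← add_mul, mul_comm]
    · rw [Set.disjoint_left]
      intro x h1 h2
      split_ifs at h1 h2 with g1 g2 <;> simp_all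
      have a1 := h1.1.2
      have a2 := h2.1.1
      linarith
    · split_ifs
      · exact hBm.preimage (by fun_prop)
      · exact MeasurableSet.empty

lemma digits_law :
    Measure.map (fun (x : ℝ) (n : ℕ) => digit n x) ((volume : Measure ℝ).restrict (Set.Ico 0 1)) =
      Measure.infinitePi (fun _ : ℕ => coin) := by
  apply Measure.eq_infinitePi
  intro s t ht
  obtain ⟨n, hn⟩ : ∃ n, s ⊆ Finset.range n := by
    obtain ⟨n, hn⟩ := s.exists_nat_subset_range
    exact ⟨n, hn⟩
  have hm : Measurable (fun (x : ℝ) (n : ℕ) => digit n x) :=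
    measurable_pi_lambda _ (fun n => measurable_digit n)
  have hpm : MeasurableSet (Set.pi (s : Set ℕ) t) :=
    MeasurableSet.pi s.countable_toSet (fun i _ => ht i)
  rw [Measure.map_apply hm hpm, Measure.restrict_apply (hm hpm)]
  have := digit_prob n (fun k => if k ∈ s then t k else univ)
  have e : (fun (x : ℝ) (n : ℕ) => digit n x) ⁻¹' (Set.pi (s : Set ℕ) t) ∩ Ico 0 1 =
      {x : ℝ | x ∈ Ico (0 : ℝ) 1 ∧ ∀ k < n, digit k x ∈ (if k ∈ s then t k else univ)} := by
    ext x
    simp only [mem_inter_iff, mem_preimage, Set.mem_pi, mem_ofPred_eq]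
    rw [and_comm]
    refine and_congr_right fun _ => ?_
    constructor
    · intro h k _
      split_ifs with hk
      · exact h k hk
      · trivial
    · intro h k hk
      have := h k (by simpa using hn hk)
      rwa [if_pos (by simpa using hk)] at this
  rw [e, this, ← Finset.prod_subset hn]
  · exact Finset.prod_congr rfl fun k hk => by rw [if_pos hk]
  · intro k _ hk
    rw [if_neg hk]; simp

/-- Threshold map from digit sequences to occupation status. -/
noncomputable def occ (p : ℝ) (h : ℕ → ℕ) : Bool :=
  if (∑' k : ℕ, (h k : ℝ) / 2 ^ (k + 1)) < p then true else false

lemma measurable_occ (p : ℝ) : Measurable (occ p) := by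
  have h1 : Measurable (fun h : ℕ → ℕ => ∑' k : ℕ, (h k : ℝ) / 2 ^ (k + 1)) := by
    have e : (fun h : ℕ → ℕ => ∑' k : ℕ, (h k : ℝ) / 2 ^ (k + 1)) =
        fun h => (∑' k : ℕ, ENNReal.ofReal ((h k : ℝ) / 2 ^ (k + 1))).toReal := by
      funext h
      rw [ENNReal.tsum_toReal_eq (fun _ => ENNReal.ofReal_ne_top)]
      congr 1
      funext k
      rw [ENNReal.toReal_ofReal (by positivity)]
    rw [e]
    refine (Measurable.tsum fun k => ?_).ennreal_toReal
    have h2 : Measurable (fun n : ℕ => ENNReal.ofReal ((n : ℝ) / 2 ^ (k + 1))) :=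
      measurable_of_countable _
    exact h2.comp (measurable_pi_apply k)
  unfold occ
  exact Measurable.ite (measurableSet_lt h1 measurable_const) measurable_const measurable_const

/-- The law of a single bond. -/
noncomputable def bondLaw (p : ℝ) : Measure Bool :=
  (Measure.infinitePi (fun _ : ℕ => coin)).map (occ p)

instance (p : ℝ) : IsProbabilityMeasure (bondLaw p) :=
  Measure.isProbabilityMeasure_map (measurable_occ p).aemeasurable

lemma P_eq (d : ℕ) (p : ℝ) : P d p = Measure.infinitePi (fun _ : Bond d => bondLaw p) := by
  have hinj : Function.Injective (fun q : Bond d × ℕ => Nat.pair (enc d q.1) q.2) := by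
    intro a b h
    have h' := Nat.pair_eq_pair.1 h
    exact Prod.ext ((exists_injective_nat (Bond d)).choose_spec h'.1) h'.2
  have hm : Measurable (fun (x : ℝ) (n : ℕ) => digit n x) :=
    measurable_pi_lambda _ (fun n => measurable_digit n)
  have ho : Measurable (fun (h : Bond d → ℕ → ℕ) (b : Bond d) => occ p (h b)) :=
    measurable_pi_lambda _ fun b => (measurable_occ p).comp (measurable_pi_apply b)
  have h1 := Measure.map_infinitePi_infinitePi_of_inj (P := fun _ : ℕ => coin) hinj
  have h2 := Measure.infinitePi_map_curry (ι := Bond d) (κ := ℕ) (X := ℕ) (fun _ _ => coin)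
  have h3 := Measure.infinitePi_map_pi (ι := Bond d)
    (fun _ : Bond d => Measure.infinitePi (fun _ : ℕ => coin)) (f := fun _ => occ p)
    (fun _ => measurable_occ p)
  have h4 : P d p = (((((volume : Measure ℝ).restrict (Set.Ico 0 1)).map
      (fun (x : ℝ) (n : ℕ) => digit n x)).map
      (fun ω (q : Bond d × ℕ) => ω (Nat.pair (enc d q.1) q.2))).map
      (MeasurableEquiv.curry (Bond d) ℕ ℕ)).map (fun h b => occ p (h b)) := by
    rw [Measure.map_map, Measure.map_map, Measure.map_map]
    · rfl
    all_goals first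
      | exact hm
      | exact ho
      | fun_prop
      | exact ho.comp (MeasurableEquiv.measurable _)
      | exact (MeasurableEquiv.measurable _).comp (by fun_prop)
      | exact (ho.comp (MeasurableEquiv.measurable _)).comp (by fun_prop)
  rw [h4, digits_law, h1, h2, h3]
  rfl

instance (d : ℕ) (p : ℝ) : IsProbabilityMeasure (P d p) := by
  rw [P_eq]; infer_instance

lemma conn_iff {d : ℕ} (ω : Config d) (x : Fin d → ℤ) (s : ℕ) (y : Fin d → ℤ) (t : ℕ)
    (hst : s ≤ t) : Connected ω x s y t ↔ ∃ v : ℕ → (Fin d → ℤ), v s = x ∧ v t = y ∧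
      ∀ j, s ≤ j → j < t → norm1 (v (j + 1) - v j) = 1 ∧ ω ((v j, j), v (j + 1)) = true := by
  unfold Connected ConnectedIn
  constructor
  · rintro (⟨rfl, rfl, _⟩ | ⟨_, v, h1, h2, _, h3⟩)
    · exact ⟨fun _ => x, rfl, rfl, fun j h1 h2 => by omega⟩
    · exact ⟨v, h1, h2, h3⟩
  · rintro ⟨v, h1, h2, h3⟩
    rcases hst.eq_or_lt with rfl | h
    · exact Or.inl ⟨h1.symm.trans h2, rfl, trivial⟩
    · exact Or.inr ⟨h, v, h1, h2, fun _ _ _ => trivial, h3⟩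

lemma conn_succ {d : ℕ} (ω : Config d) (x : Fin d → ℤ) (s : ℕ) (y : Fin d → ℤ) (t : ℕ)
    (hst : s ≤ t) : Connected ω x s y (t + 1) ↔
      ∃ z, Connected ω x s z t ∧ norm1 (y - z) = 1 ∧ ω ((z, t), y) = true := by
  rw [conn_iff ω x s y (t + 1) (by omega)]
  constructor
  · rintro ⟨v, h1, h2, h3⟩
    refine ⟨v t, (conn_iff ω x s (v t) t hst).2 ⟨v, h1, rfl, fun j a b => h3 j a (by omega)⟩, ?_⟩
    rw [← h2]
    exact h3 t hst (by omega)
  · rintro ⟨z, hz, h4, h5⟩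
    obtain ⟨v, h1, h2, h3⟩ := (conn_iff ω x s z t hst).1 hz
    refine ⟨fun j => if j = t + 1 then y else v j, ?_, by simp, ?_⟩
    · simp only
      rw [if_neg (by omega), h1]
    · intro j a b
      simp only
      rw [if_neg (show j ≠ t + 1 by omega)]
      rcases (show j = t ∨ j < t by omega) with rfl | hj
      · rw [if_pos rfl, h2]; exact ⟨h4, h5⟩
      · rw [if_neg (show j + 1 ≠ t + 1 by omega)]; exact h3 j a hj

lemma meas_conn {d : ℕ} (m : MeasurableSpace (Config d)) (x : Fin d → ℤ) (s t : ℕ) (hst : s ≤ t)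
    (hm : ∀ a j b, s ≤ j → j < t → MeasurableSet[m] {ω : Config d | ω ((a, j), b) = true}) :
    ∀ y, MeasurableSet[m] {ω : Config d | Connected ω x s y t} := by
  induction t, hst using Nat.le_induction with
  | base =>
    intro y
    have : {ω : Config d | Connected ω x s y s} = {ω | x = y} := by
      ext ω
      simp [Connected, ConnectedIn]
    rw [this]
    exact MeasurableSet.const _
  | succ t hst ih =>
    intro y
    have : {ω : Config d | Connected ω x s y (t + 1)} =
        ⋃ z, ({ω | Connected ω x s z t} ∩ ({ω | norm1 (y - z) = 1} ∩
          {ω | ω ((z, t), y) = true})) := by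
      ext ω
      simp [conn_succ ω x s y t hst]
    rw [this]
    refine MeasurableSet.iUnion fun z => ?_
    refine (ih (fun a j b h1 h2 => hm a j b h1 (by omega)) z).inter ?_
    exact (MeasurableSet.const _).inter (hm z t y hst (by omega))

lemma conn_split {d : ℕ} (ω : Config d) (x : Fin d → ℤ) (s t : ℕ) (hst : s ≤ t)
    (h : Connected ω 0 0 x t) :
    (∃ y, Connected ω 0 0 y s) ∧ ∃ y, Connected ω y s x t := by
  obtain ⟨v, h1, h2, h3⟩ := (conn_iff ω 0 0 x t (by omega)).1 h
  exact ⟨⟨v s, (conn_iff _ _ _ _ _ (by omega)).2 ⟨v, h1, rfl, fun j a b => h3 j a (by omega)⟩⟩,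
    ⟨v s, (conn_iff _ _ _ _ _ hst).2 ⟨v, rfl, h2, fun j a b => h3 j (by omega) b⟩⟩⟩

lemma norm1_neg {d : ℕ} (x : Fin d → ℤ) : norm1 (-x) = norm1 x := by
  simp [norm1]

/-- Time reversal of bonds about the vertex `(x, 2s)`. -/
def rev {d : ℕ} (x : Fin d → ℤ) (s : ℕ) (b : Bond d) : Bond d :=
  ((b.2 + x, if b.1.2 < 2 * s then 2 * s - 1 - b.1.2 else b.1.2), b.1.1 + x)

lemma rev_inj {d : ℕ} (x : Fin d → ℤ) (s : ℕ) : Function.Injective (rev x s) := by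
  rintro ⟨⟨a, j⟩, b⟩ ⟨⟨a', j'⟩, b'⟩ h
  simp only [rev, Prod.mk.injEq, add_left_inj] at h
  obtain ⟨⟨rfl, h⟩, rfl⟩ := h
  have : j = j' := by split_ifs at h <;> omega
  rw [this]

lemma conn_rev {d : ℕ} (ω : Config d) (x : Fin d → ℤ) (s : ℕ) :
    (∃ y, Connected ω y s x (2 * s)) ↔ ∃ y, Connected (fun b => ω (rev x s b)) 0 0 y s := by
  constructor
  · rintro ⟨y, h⟩
    obtain ⟨v, h1, h2, h3⟩ := (conn_iff ω y s x (2 * s) (by omega)).1 h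
    refine ⟨v s - x, (conn_iff _ _ _ _ _ (by omega)).2
      ⟨fun j => v (2 * s - j) - x, by simp [h2], by
        simp only
        rw [show 2 * s - s = s by omega], ?_⟩⟩
    intro j _ hj
    have := h3 (2 * s - 1 - j) (by omega) (by omega)
    rw [show 2 * s - 1 - j + 1 = 2 * s - j by omega] at this
    simp only [rev, sub_add_cancel]
    rw [if_pos (by omega), show 2 * s - (j + 1) = 2 * s - 1 - j by omega]
    refine ⟨?_, this.2⟩
    rw [← this.1, ← norm1_neg]
    congr 1; abel
  · rintro ⟨y, h⟩
    obtain ⟨v, h1, h2, h3⟩ := (conn_iff _ 0 0 y s (by omega)).1 h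
    refine ⟨y + x, (conn_iff _ _ _ _ _ (by omega)).2
      ⟨fun j => v (2 * s - j) + x, ?_, by simp [h1], ?_⟩⟩
    · simp only
      rw [show 2 * s - s = s by omega, h2]
    intro j hj1 hj2
    have := h3 (2 * s - 1 - j) (by omega) (by omega)
    rw [show 2 * s - 1 - j + 1 = 2 * s - j by omega] at this
    simp only [rev] at this
    rw [if_pos (by omega), show 2 * s - 1 - (2 * s - 1 - j) = j by omega] at this
    simp only
    rw [show 2 * s - (j + 1) = 2 * s - 1 - j by omega]
    refine ⟨?_, this.2⟩
    rw [← this.1, ← norm1_neg]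
    congr 1; abel

lemma coord_meas {d : ℕ} (b : Bond d) : MeasurableSet {ω : Config d | ω b = true} :=
  measurableSet_eq_fun (measurable_pi_apply b) measurable_const

lemma prob_rev (d : ℕ) (p : ℝ) (x : Fin d → ℤ) (s : ℕ) :
    P d p {ω | ∃ y, Connected ω y s x (2 * s)} = P d p {ω | ∃ y, Connected ω 0 0 y s} := by
  have h1 := Measure.map_infinitePi_infinitePi_of_inj (P := fun _ : Bond d => bondLaw p)
    (rev_inj x s)
  have hA : MeasurableSet {ω : Config d | ∃ y, Connected ω 0 0 y s} := by
    have : {ω : Config d | ∃ y, Connected ω 0 0 y s} = ⋃ y, {ω | Connected ω 0 0 y s} := by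
      ext ω; simp
    rw [this]
    exact MeasurableSet.iUnion fun y => meas_conn _ 0 0 s (by omega)
      (fun a j b _ _ => coord_meas _) y
  rw [P_eq]
  conv_rhs => rw [← h1]
  rw [Measure.map_apply (by fun_prop) hA]
  congr 1
  ext ω
  exact conn_rev ω x s

open ProbabilityTheory in
lemma indep_events (d : ℕ) (p : ℝ) (x : Fin d → ℤ) (s : ℕ) :
    P d p ({ω | ∃ y, Connected ω 0 0 y s} ∩ {ω | ∃ y, Connected ω y s x (2 * s)}) =
      P d p {ω | ∃ y, Connected ω 0 0 y s} * P d p {ω | ∃ y, Connected ω y s x (2 * s)} := by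
  have hI : iIndepFun (fun (b : Bond d) (ω : Config d) => ω b) (P d p) := by
    rw [P_eq]
    exact iIndepFun_infinitePi (X := fun _ ω => ω) (by fun_prop)
  let m : Bond d → MeasurableSpace (Config d) := fun b =>
    MeasurableSpace.comap (fun ω : Config d => ω b) inferInstance
  have hI' : iIndep m (P d p) := hI.iIndep
  have hle : ∀ b, m b ≤ MeasurableSpace.pi := fun b => (measurable_pi_apply b).comap_le
  have hdis : Disjoint {b : Bond d | b.1.2 < s} {b : Bond d | s ≤ b.1.2} := by
    rw [Set.disjoint_left]; intro b h1 h2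
    simp only [mem_ofPred_eq] at h1 h2
    omega
  have key := indep_iSup_of_disjoint hle hI' hdis
  have hc : ∀ (S : Set (Bond d)) (b : Bond d), b ∈ S →
      MeasurableSet[⨆ i ∈ S, m i] {ω : Config d | ω b = true} := by
    intro S b hb
    have : m b ≤ ⨆ i ∈ S, m i := le_iSup₂_of_le b hb le_rfl
    exact this _ ⟨{true}, MeasurableSet.singleton _, rfl⟩
  refine (Indep_iff _ _ _).1 key _ _ ?_ ?_
  · have : {ω : Config d | ∃ y, Connected ω 0 0 y s} = ⋃ y, {ω | Connected ω 0 0 y s} := by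
      ext ω; simp
    rw [this]
    exact MeasurableSet.iUnion fun y => meas_conn _ 0 0 s (by omega)
      (fun a j b _ h => hc _ _ h) y
  · have : {ω : Config d | ∃ y, Connected ω y s x (2 * s)} =
        ⋃ y, {ω | Connected ω y s x (2 * s)} := by
      ext ω; simp
    rw [this]
    exact MeasurableSet.iUnion fun y => meas_conn _ y s (2 * s) (by omega)
      (fun a j b h _ => hc _ _ h) x

lemma tau_le (d : ℕ) (p : ℝ) (x : Fin d → ℤ) (s : ℕ) :
    tau d p x (2 * s) ≤ theta d p s ^ 2 := by
  unfold tau theta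
  rw [sq, ← ENNReal.toReal_mul]
  refine ENNReal.toReal_mono
    (ENNReal.mul_ne_top (measure_ne_top _ _) (measure_ne_top _ _)) ?_
  conv_rhs => rw [← prob_rev d p x s]
  rw [prob_rev d p x s]
  conv_rhs => rhs; rw [← prob_rev d p x s]
  rw [← indep_events]
  exact measure_mono fun ω h => conn_split ω x s (2 * s) (by omega) h

lemma conn_bound {d : ℕ} (ω : Config d) (t : ℕ) : ∀ x, Connected ω 0 0 x t →
    ∀ i, |x i| ≤ t := by
  induction t with
  | zero =>
    intro x h i
    obtain ⟨v, h1, h2, _⟩ := (conn_iff ω 0 0 x 0 le_rfl).1 h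
    rw [← h2, h1]; simp
  | succ t ih =>
    intro x h i
    obtain ⟨z, hz, h1, _⟩ := (conn_succ ω 0 0 x t (by omega)).1 h
    have a := ih z hz i
    have b : |(x - z) i| ≤ norm1 (x - z) :=
      Finset.single_le_sum (f := fun i => |(x - z) i|) (fun _ _ => abs_nonneg _)
        (Finset.mem_univ i)
    have c : |x i| ≤ |(x - z) i| + |z i| := by
      have := abs_add_le ((x - z) i) (z i)
      simpa using this
    push_cast
    linarith

lemma tau_zero (d : ℕ) (p : ℝ) (t : ℕ) (x : Fin d → ℤ)
    (hx : x ∉ Finset.Icc (fun _ => -(t : ℤ)) (fun _ : Fin d => (t : ℤ))) : tau d p x t = 0 := by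
  unfold tau
  have : {ω : Config d | Connected ω 0 0 x t} = ∅ := by
    ext ω
    simp only [mem_ofPred_eq, mem_empty_iff_false, iff_false]
    intro h
    apply hx
    rw [Finset.mem_Icc]
    have := conn_bound ω t x h
    exact ⟨fun i => (abs_le.1 (this i)).1, fun i => (abs_le.1 (this i)).2⟩
  rw [this]; simp

lemma tau_nonneg (d : ℕ) (p : ℝ) (x : Fin d → ℤ) (t : ℕ) : 0 ≤ tau d p x t :=
  ENNReal.toReal_nonneg

lemma main_aux (d : ℕ) (p : ℝ) (s : ℕ) (hchi : 0 < chi d p (2 * s)) :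
    chi d p (2 * s) ≤ 4 / 3 * (4 * xi d p (2 * s) + 1) ^ d * theta d p s ^ 2 := by
  set t := 2 * s with ht
  set F := Finset.Icc (fun _ => -(t : ℤ)) (fun _ : Fin d => (t : ℤ)) with hF
  have hchi_eq : chi d p t = ∑ x ∈ F, tau d p x t :=
    tsum_eq_sum fun x hx => tau_zero d p t x hx
  have hM_eq : (∑' x : Fin d → ℤ, (normSq x : ℝ) * tau d p x t) =
      ∑ x ∈ F, (normSq x : ℝ) * tau d p x t :=
    tsum_eq_sum fun x hx => by rw [tau_zero d p t x hx, mul_zero]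
  set M := ∑ x ∈ F, (normSq x : ℝ) * tau d p x t with hM
  have hns : ∀ x : Fin d → ℤ, (0 : ℝ) ≤ normSq x := fun x => by
    have : 0 ≤ normSq x := Finset.sum_nonneg fun i _ => sq_nonneg _
    exact_mod_cast this
  have hM0 : 0 ≤ M := Finset.sum_nonneg fun x _ => mul_nonneg (hns x) (tau_nonneg ..)
  set ξ := xi d p t with hξ
  have hξ0 : 0 ≤ ξ := Real.sqrt_nonneg _
  have hξ2 : ξ ^ 2 * chi d p t = M := by
    rw [hξ, xi, hM_eq, Real.sq_sqrt (div_nonneg hM0 hchi.le), div_mul_cancel₀ _ hchi.ne']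
  set N : ℕ := ⌊2 * ξ⌋₊ with hN
  set G := Finset.Icc (fun _ => -(N : ℤ)) (fun _ : Fin d => (N : ℤ)) with hG
  -- outside `G`, the squared norm is large
  have hout : ∀ x : Fin d → ℤ, x ∉ G → (2 * ξ) ^ 2 < normSq x := by
    intro x hx
    have : ∃ i, (N : ℤ) < |x i| := by
      by_contra hcon
      push Not at hcon
      exact hx (Finset.mem_Icc.2 ⟨fun i => (abs_le.1 (hcon i)).1, fun i => (abs_le.1 (hcon i)).2⟩)
    obtain ⟨i, hi⟩ := this
    have h1 : (N : ℤ) + 1 ≤ |x i| := hi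
    have h2 : (N : ℝ) + 1 ≤ |(x i : ℝ)| := by exact_mod_cast h1
    have h3 : 2 * ξ < N + 1 := Nat.lt_floor_add_one _
    have h4 : (x i) ^ 2 ≤ normSq x :=
      Finset.single_le_sum (f := fun i => (x i) ^ 2) (fun _ _ => sq_nonneg _) (Finset.mem_univ i)
    have h5 : ((x i : ℝ)) ^ 2 ≤ normSq x := by exact_mod_cast h4
    have h6 : (2 * ξ) ^ 2 < |(x i : ℝ)| ^ 2 :=
      pow_lt_pow_left₀ (by linarith) (by linarith) (by norm_num)
    rw [sq_abs] at h6
    linarith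
  have hsplit : chi d p t = ∑ x ∈ F.filter (· ∈ G), tau d p x t +
      ∑ x ∈ F.filter (· ∉ G), tau d p x t := by
    rw [hchi_eq, Finset.sum_filter_add_sum_filter_not]
  set R := ∑ x ∈ F.filter (· ∉ G), tau d p x t with hR
  have hcheb : (2 * ξ) ^ 2 * R ≤ M := by
    rw [hR, Finset.mul_sum]
    calc _ ≤ ∑ x ∈ F.filter (· ∉ G), (normSq x : ℝ) * tau d p x t :=
          Finset.sum_le_sum fun x hx => mul_le_mul_of_nonneg_right
            (hout x (Finset.mem_filter.1 hx).2).le (tau_nonneg ..)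
      _ ≤ M := Finset.sum_le_sum_of_subset_of_nonneg (Finset.filter_subset _ _)
            fun x _ _ => mul_nonneg (hns x) (tau_nonneg ..)
  have hR4 : R ≤ chi d p t / 4 := by
    rcases hξ0.eq_or_lt with h0 | hpos
    · have hMz : M = 0 := by rw [← hξ2, ← h0]; ring
      have hz := (Finset.sum_eq_zero_iff_of_nonneg
        (fun x _ => mul_nonneg (hns x) (tau_nonneg d p x t))).1 (hM.symm.trans hMz)
      have : R = 0 := by
        refine Finset.sum_eq_zero fun x hx => ?_
        have hx' := Finset.mem_filter.1 hx
        have h1 := hz x hx'.1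
        have h2 := hout x hx'.2
        rw [← h0] at h2
        rcases mul_eq_zero.1 h1 with h | h
        · rw [h] at h2; norm_num at h2
        · exact h
      rw [this]; positivity
    · rw [← hξ2] at hcheb
      have : 0 < ξ ^ 2 := by positivity
      have h2 : ξ ^ 2 * (4 * R) ≤ ξ ^ 2 * chi d p t := by linarith
      have := le_of_mul_le_mul_left h2 this
      linarith
  have hcard : (G.card : ℝ) ≤ (4 * ξ + 1) ^ d := by
    have : G.card = (2 * N + 1) ^ d := by
      rw [hG, Pi.card_Icc]
      simp only [Int.card_Icc, Finset.prod_const, Finset.card_univ, Fintype.card_fin]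
      congr 1; omega
    rw [this]
    push_cast
    have : (N : ℝ) ≤ 2 * ξ := Nat.floor_le (by positivity)
    exact pow_le_pow_left₀ (by positivity) (by linarith) _
  have hin : ∑ x ∈ F.filter (· ∈ G), tau d p x t ≤ (4 * ξ + 1) ^ d * theta d p s ^ 2 := by
    calc _ ≤ ∑ x ∈ G, tau d p x t :=
          Finset.sum_le_sum_of_subset_of_nonneg (fun x hx => (Finset.mem_filter.1 hx).2)
            fun x _ _ => tau_nonneg ..
      _ ≤ ∑ x ∈ G, theta d p s ^ 2 := Finset.sum_le_sum fun x _ => tau_le d p x s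
      _ = G.card * theta d p s ^ 2 := by simp
      _ ≤ _ := mul_le_mul_of_nonneg_right hcard (sq_nonneg _)
  linarith

/-- hyperscaling inequality, quantitative form: for every dimension
`d ≥ 1`, every `p ∈ [0,1]` and every even `t ≥ 2` with `χ_t > 0`,
`χ_t ≤ (4/3) (4 ξ_t + 1)^d θ_{t/2}²`. -/
theorem hyperscaling_inequality_quantitative (d : ℕ) (hd : 1 ≤ d) (p : ℝ)
    (hp : p ∈ Set.Icc (0 : ℝ) 1) (t : ℕ) (ht : 2 ≤ t) (hte : Even t)
    (hchi : 0 < chi d p t) :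
    chi d p t ≤ 4 / 3 * (4 * xi d p t + 1) ^ d * theta d p (t / 2) ^ 2 := by
  obtain ⟨s, rfl⟩ := hte
  rw [← two_mul] at hchi ⊢
  rw [Nat.mul_div_cancel_left s (by norm_num)]
  exact main_aux d p s hchi

end OrientedPercolation
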